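/- Let G = A_n be the alternating group of degree n and let g ∈ G. Then there exists a positive integer e with e^2 dividing n! such that e · ℤ_{ℚ(g)} ⊆ ℤ[g]. -/

import Mathlib

open CategoryTheory Module Pointwise
open scoped MatrixGroups

/-- The set of all values `χ(g)` of irreducible complex characters `χ` of `G`. -/
noncomputable def charValues (G : Type) [Group G] : Set ℂ :=
  {z : ℂ | ∃ V : FDRep ℂ G, Simple V ∧ ∃ g : G, V.character g = z}

/-- `ℚ(G)`, the field of character values of `G`, as a subfield of `ℂ`. -/
noncomputable def charField (G : Type) [Group G] : Subfield ℂ :=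
  Subfield.closure (charValues G)

/-- `ℤ[G]`, the subring of `ℂ` generated by the character values of `G`. -/
noncomputable def charRing (G : Type) [Group G] : Subring ℂ :=
  Subring.closure (charValues G)

/-- The ring of integers of a subfield `K` of `ℂ`, i.e. the elements of `K` integral
over `ℤ`, as a subring of `ℂ`. -/
noncomputable def ringOfIntIn (K : Subfield ℂ) : Subring ℂ :=
  (integralClosure ℤ ℂ).toSubring ⊓ K.toSubring

/-- The additive quotient group `ℤ_{ℚ(G)}/ℤ[G]`. -/
noncomputable def charQuot (G : Type) [Group G] :=
  ↥((ringOfIntIn (charField G)).toAddSubgroup) ⧸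
    ((charRing G).toAddSubgroup.addSubgroupOf (ringOfIntIn (charField G)).toAddSubgroup)

noncomputable instance (G : Type) [Group G] : AddCommGroup (charQuot G) := by
  unfold charQuot; infer_instance

/-- The `m`-th cyclotomic field `ℚ(ζ_m)`, as the subfield of `ℂ` generated by the
`m`-th roots of unity. -/
noncomputable def cycField (m : ℕ) : Subfield ℂ :=
  Subfield.closure {z : ℂ | z ^ m = 1}

/-- The set of values `χ(g)` at a fixed `g` of irreducible complex characters `χ` of `G`. -/
noncomputable def charValuesAt {G : Type} [Group G] (g : G) : Set ℂ :=
  {z : ℂ | ∃ V : FDRep ℂ G, Simple V ∧ V.character g = z}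

/-- `ℚ(g)`, the subfield of `ℂ` generated by one column of the character table. -/
noncomputable def charFieldAt {G : Type} [Group G] (g : G) : Subfield ℂ :=
  Subfield.closure (charValuesAt g)

/-- `ℤ[g]`, the subring of `ℂ` generated by one column of the character table. -/
noncomputable def charRingAt {G : Type} [Group G] (g : G) : Subring ℂ :=
  Subring.closure (charValuesAt g)

open Polynomial in
theorem Module.End.exists_trace_pow_eq_sum {V : Type*} [AddCommGroup V] [Module ℂ V]
    [FiniteDimensional ℂ V] (A : End ℂ V) {N : ℕ} (hN : N ≠ 0) (hA : A ^ N = 1) :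
    ∃ (s : Finset ℂ) (m : ℂ → ℕ), (∀ μ ∈ s, μ ^ N = 1) ∧
      ∀ k : ℕ, LinearMap.trace ℂ V (A ^ k) = ∑ μ ∈ s, (m μ : ℂ) * μ ^ k := by
  classical
  have hss : A.IsSemisimple := by
    refine isSemisimple_of_squarefree_aeval_eq_zero (p := X ^ N - 1)
      (X_pow_sub_one_separable_iff.2 (by exact_mod_cast hN)).squarefree ?_
    simp [hA]
  have hint : DirectSum.IsInternal A.eigenspace := by
    rw [DirectSum.isInternal_submodule_iff_iSupIndep_and_iSup_eq_top]
    refine ⟨A.eigenspaces_iSupIndep, ?_⟩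
    rw [← A.iSup_maxGenEigenspace_eq_top]
    simp_rw [hss.isFinitelySemisimple.maxGenEigenspace_eq_eigenspace]
  have hfin : {μ | A.eigenspace μ ≠ ⊥}.Finite :=
    WellFoundedGT.finite_ne_bot_of_iSupIndep A.eigenspaces_iSupIndep
  have hpow : ∀ (k : ℕ) (μ : ℂ) (v : V), v ∈ A.eigenspace μ → (A ^ k) v = μ ^ k • v := by
    intro k μ v hv
    rw [mem_eigenspace_iff] at hv
    induction k with
    | zero => simp
    | succ k ih => rw [pow_succ, End.mul_apply, hv, map_smul, ih, smul_smul, pow_succ, mul_comm]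
  refine ⟨hfin.toFinset, fun μ => finrank ℂ (A.eigenspace μ), fun μ hμ => ?_, fun k => ?_⟩
  · obtain ⟨v, hv, hv0⟩ := Submodule.exists_mem_ne_zero_of_ne_bot (hfin.mem_toFinset.1 hμ)
    have h := hpow N μ v hv
    rw [hA, End.one_apply] at h
    have : (μ ^ N - 1) • v = 0 := by rw [sub_smul, ← h, one_smul, sub_self]
    exact sub_eq_zero.1 ((smul_eq_zero.1 this).resolve_right hv0)
  · have hmap : ∀ μ, Set.MapsTo (A ^ k) (A.eigenspace μ) (A.eigenspace μ) := fun μ v hv => by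
      rw [hpow k μ v hv]; exact Submodule.smul_mem _ _ hv
    rw [LinearMap.trace_eq_sum_trace_restrict' hint hfin hmap]
    refine Finset.sum_congr rfl fun μ _ => ?_
    have : (A ^ k).restrict (hmap μ) = μ ^ k • LinearMap.id := by
      ext v
      exact hpow k μ v v.2
    rw [this, map_smul, LinearMap.trace_id, smul_eq_mul, mul_comm]

theorem Equiv.Perm.cycleType_pow_of_coprime {α : Type*} [Fintype α] [DecidableEq α]
    (σ : Perm α) {k : ℕ} (hk : k.Coprime (orderOf σ)) : (σ ^ k).cycleType = σ.cycleType := by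
  induction σ using cycle_induction_on with
  | base_one => simp
  | base_cycles σ hσ =>
    rw [hσ.cycleType, (hσ.pow_iff.2 hk).cycleType, support_pow_coprime hk]
  | induction_disjoint σ τ hd _ h₁ h₂ =>
    rw [hd.orderOf] at hk
    rw [hd.commute.mul_pow, (hd.pow_disjoint_pow k k).cycleType_mul, hd.cycleType_mul,
      h₁ (hk.coprime_dvd_right (Nat.dvd_lcm_left _ _)),
      h₂ (hk.coprime_dvd_right (Nat.dvd_lcm_right _ _))]

/-- The integers are the integral elements fixed by the whole Galois group over `ℚ`. -/
theorem exists_intCast_eq_of_forall_fixed {E : Type*} [Field E] [CharZero E] [Algebra ℚ E]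
    [IsGalois ℚ E] {x : E} (hx : IsIntegral ℤ x) (h : ∀ τ : E ≃ₐ[ℚ] E, τ x = x) :
    ∃ m : ℤ, (m : E) = x := by
  obtain ⟨q, rfl⟩ := IntermediateField.mem_bot.1 ((InfiniteGalois.mem_bot_iff_fixed x).2 h)
  obtain ⟨m, rfl⟩ := IsIntegrallyClosed.isIntegral_iff.1
    ((isIntegral_algebraMap_iff (algebraMap ℚ E).injective).1 hx)
  exact ⟨m, by simp⟩

/-- If the Galois group acts on `S` through the two-element set `{1, σ}`, then
`S` generates an order in a quadratic field, and we compare its conductor with the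
differences `s - σ s`. -/
theorem exists_conductor {E : Type*} [Field E] [CharZero E] [Algebra ℚ E]
    [IsGalois ℚ E] {S : Set E} (hS : ∀ s ∈ S, IsIntegral ℤ s) (σ : E ≃ₐ[ℚ] E)
    (hσ : ∃ s ∈ S, σ s ≠ s)
    (hall : ∀ τ : E ≃ₐ[ℚ] E, (∀ s ∈ S, τ s = s) ∨ (∀ s ∈ S, τ s = σ s)) :
    ∃ f : ℕ, 0 < f ∧ (∀ x ∈ Subfield.closure S, IsIntegral ℤ x → (f : E) * x ∈ Subring.closure S) ∧
      ∀ s ∈ S, ∃ c : ℤ, (s - σ s) ^ 2 = ((f ^ 2 * c : ℤ) : E) := by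
  have ext_closure : ∀ τ ρ : E ≃ₐ[ℚ] E, (∀ s ∈ S, τ s = ρ s) →
      ∀ x ∈ Subfield.closure S, τ x = ρ x := fun τ ρ h x hx =>
    RingHom.eqOn_field_closure (f := (τ : E →+* E)) (g := (ρ : E →+* E)) (fun s hs => h s hs) hx
  have hall' : ∀ τ : E ≃ₐ[ℚ] E, (∀ x ∈ Subfield.closure S, τ x = x) ∨
      (∀ x ∈ Subfield.closure S, τ x = σ x) := fun τ =>
    (hall τ).imp (ext_closure τ AlgEquiv.refl) (ext_closure τ σ)
  obtain ⟨s₀, hs₀, hne⟩ := hσ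
  have hint : ∀ x : E, IsIntegral ℤ x → IsIntegral ℤ (x - σ x) := fun x hx =>
    hx.sub (hx.map (σ.toAlgHom.restrictScalars ℤ))
  have hprod : ∀ x ∈ Subfield.closure S, ∀ y ∈ Subfield.closure S, IsIntegral ℤ x →
      IsIntegral ℤ y → ∃ m : ℤ, (m : E) = (x - σ x) * (y - σ y) := by
    intro x hx y hy hxi hyi
    refine exists_intCast_eq_of_forall_fixed ((hint x hxi).mul (hint y hyi)) fun τ => ?_
    have hτσ : ∀ z ∈ Subfield.closure S, τ z = σ z → τ (σ z) = z := by
      intro z hz hz'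
      rcases hall' (τ * σ) with h | h
      · exact h z hz
      · have : σ z = z := τ.injective ((h z hz).trans hz'.symm)
        rw [this, hz', this]
    rcases hall' τ with h | h
    · have h2 : ∀ z ∈ Subfield.closure S, τ (σ z) = σ z := by
        rcases hall' (τ * σ) with h2 | h2
        · exact absurd (τ.injective (((h2 s₀ (Subfield.subset_closure hs₀)).trans
            (h s₀ (Subfield.subset_closure hs₀)).symm))) hne
        · exact h2
      rw [map_mul, map_sub, map_sub, h x hx, h y hy, h2 x hx, h2 y hy]
    · rw [map_mul, map_sub, map_sub, h x hx, h y hy, hτσ x hx (h x hx), hτσ y hy (h y hy)]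
      ring
  have hSc : ∀ s ∈ S, s ∈ Subfield.closure S := fun s hs => Subfield.subset_closure hs
  have hRc : ∀ x ∈ Subring.closure S, x ∈ Subfield.closure S ∧ IsIntegral ℤ x := fun x hx =>
    (Subring.closure_le (t := (Subfield.closure S).toSubring ⊓
      (integralClosure ℤ E).toSubring)).2 (fun s hs => ⟨hSc s hs, hS s hs⟩) hx
  set δ := s₀ - σ s₀ with hδ
  have hδ0 : δ ≠ 0 := sub_ne_zero.2 hne.symm
  let H : (T : Subring E) → AddSubgroup ℤ := fun T =>
    (T.toAddSubgroup.map
      ((AddMonoidHom.mulRight δ).comp (AddMonoidHom.id E - (σ : E →+ E)))).comap (Int.castAddHom E)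
  have hH : ∀ (T : Subring E) (m : ℤ), m ∈ H T ↔ ∃ x ∈ T, (x - σ x) * δ = m := fun T m => by
    simp [H, sub_mul]
  let O : Subring E := (Subfield.closure S).toSubring ⊓ (integralClosure ℤ E).toSubring
  have hO : ∀ x, x ∈ O ↔ x ∈ Subfield.closure S ∧ IsIntegral ℤ x := fun x => Iff.rfl
  obtain ⟨a, ha⟩ := Int.subgroup_cyclic (H O)
  obtain ⟨b, hb⟩ := Int.subgroup_cyclic (H (Subring.closure S))
  have hdva : ∀ m : ℤ, m ∈ H O ↔ a ∣ m := fun m => by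
    rw [ha, AddSubgroup.mem_closure_singleton]; simp [dvd_iff_exists_eq_mul_left, eq_comm]
  have hdvb : ∀ m : ℤ, m ∈ H (Subring.closure S) ↔ b ∣ m := fun m => by
    rw [hb, AddSubgroup.mem_closure_singleton]; simp [dvd_iff_exists_eq_mul_left, eq_comm]
  have hRO : ∀ x ∈ Subring.closure S, x ∈ O := fun x hx => hRc x hx
  have hab : a ∣ b := by
    rw [← hdva, hH]
    obtain ⟨x, hx, h⟩ := (hH _ _).1 ((hdvb b).2 dvd_rfl)
    exact ⟨x, hRO x hx, h⟩
  have hb0 : b ≠ 0 := by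
    rintro rfl
    obtain ⟨m, hm⟩ := hprod s₀ (hSc s₀ hs₀) s₀ (hSc s₀ hs₀) (hS s₀ hs₀) (hS s₀ hs₀)
    have := (hdvb m).1 ((hH _ _).2 ⟨s₀, Subring.subset_closure hs₀, hm.symm⟩)
    rw [zero_dvd_iff] at this
    rw [this] at hm
    simp [← hδ, hδ0] at hm
  obtain ⟨f, rfl⟩ := hab
  have hf0 : f ≠ 0 := right_ne_zero_of_mul hb0
  have key : ∀ x ∈ O, (f : E) * x ∈ Subring.closure S := by
    intro x hx
    obtain ⟨m, hm⟩ := hprod x hx.1 s₀ (hSc s₀ hs₀) hx.2 (hS s₀ hs₀)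
    rw [← hδ] at hm
    obtain ⟨c, rfl⟩ := (hdva m).1 ((hH _ _).2 ⟨x, hx, hm.symm⟩)
    obtain ⟨r, hr, hr'⟩ := (hH _ _).1 ((hdvb (a * f * c)).2 (dvd_mul_right _ _))
    have hfix : f * x - r = σ (f * x - r) := by
      have h1 : (f * (x - σ x) - (r - σ r)) * δ = 0 := by
        rw [sub_mul, hr', mul_assoc, ← hm]; push_cast; ring
      have h2 := (mul_eq_zero.1 h1).resolve_right hδ0
      rw [map_sub, map_mul, map_intCast]
      linear_combination h2
    have hmem : (f : E) * x - r ∈ O :=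
      O.sub_mem (O.mul_mem (intCast_mem O f) hx) (hRO r hr)
    obtain ⟨z, hz⟩ := exists_intCast_eq_of_forall_fixed hmem.2 fun τ =>
      (hall' τ).elim (fun h => h _ hmem.1) (fun h => (h _ hmem.1).trans hfix.symm)
    rw [← sub_add_cancel ((f : E) * x) r, ← hz]
    exact Subring.add_mem _ (intCast_mem _ z) hr
  refine ⟨f.natAbs, Int.natAbs_pos.2 hf0, fun x hx hxi => ?_, fun s hs => ?_⟩
  · have h := key x ⟨hx, hxi⟩
    rcases Int.natAbs_eq f with hf | hf
    · rwa [hf, Int.cast_natCast] at h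
    · rw [hf, Int.cast_neg, Int.cast_natCast, neg_mul] at h
      exact neg_mem_iff.1 h
  · obtain ⟨x, hx, hxa⟩ := (hH _ _).1 ((hdva a).2 dvd_rfl)
    obtain ⟨m, hm⟩ := hprod s (hSc s hs) s₀ (hSc s₀ hs₀) (hS s hs) (hS s₀ hs₀)
    rw [← hδ] at hm
    obtain ⟨c, rfl⟩ :=
      (hdvb m).1 ((hH _ _).2 ⟨s, Subring.subset_closure hs, hm.symm⟩)
    obtain ⟨d, hd⟩ := hprod x hx.1 x hx.1 hx.2 hx.2
    refine ⟨d * c ^ 2, ?_⟩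
    have h1 : s - σ s = f * c * (x - σ x) := by
      apply mul_right_cancel₀ hδ0
      rw [mul_assoc, hxa, ← hm]; push_cast; ring
    rw [h1, Int.natCast_natAbs, sq_abs]
    push_cast
    rw [hd]
    ring

theorem MonoidAlgebra.trace_mulLeftRight_of {G : Type*} [Group G] [Finite G] (a b : G) :
    LinearMap.trace ℂ (MonoidAlgebra ℂ G)
        (LinearMap.mulLeftRight ℂ (MonoidAlgebra.of ℂ G a, MonoidAlgebra.of ℂ G b)) =
      Nat.card {x : G // a * x * b = x} := by
  classical
  have := Fintype.ofFinite G
  rw [LinearMap.trace_eq_matrix_trace ℂ (MonoidAlgebra.basis G ℂ), Matrix.trace,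
    Nat.card_eq_fintype_card, Fintype.card_subtype, Finset.card_filter, Nat.cast_sum]
  refine Finset.sum_congr rfl fun x _ => ?_
  rw [Matrix.diag_apply, LinearMap.toMatrix_apply]
  simp [MonoidAlgebra.basis, Finsupp.single_apply]

theorem Matrix.trace_pi_mulLeftRight {ι : Type*} [Fintype ι] {m : ι → Type*}
    [∀ i, Fintype (m i)] (A B : ∀ i, Matrix (m i) (m i) ℂ) :
    LinearMap.trace ℂ (∀ i, Matrix (m i) (m i) ℂ) (LinearMap.mulLeftRight ℂ (A, B)) =
      ∑ i, (A i).trace * (B i).trace := by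
  classical
  rw [LinearMap.trace_eq_matrix_trace ℂ (Pi.basis fun i => Matrix.stdBasis ℂ (m i) (m i)),
    Matrix.trace, Fintype.sum_sigma]
  refine Finset.sum_congr rfl fun i _ => ?_
  rw [Matrix.trace, Matrix.trace, Finset.sum_mul_sum, Fintype.sum_prod_type]
  refine Finset.sum_congr rfl fun r _ => Finset.sum_congr rfl fun s _ => ?_
  rw [Matrix.diag_apply, LinearMap.toMatrix_apply, Pi.basis_apply, Pi.basis_repr,
    Matrix.stdBasis_eq_single]
  simp [Matrix.stdBasis, Matrix.mul_apply, Matrix.single_apply, ite_and]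

theorem FDRep.simple_of_span_eq_top {G : Type} [Group G] [Finite G] {W : Type}
    [AddCommGroup W] [Module ℂ W] [FiniteDimensional ℂ W] [Nontrivial W]
    (ρ : Representation ℂ G W) (h : Submodule.span ℂ (Set.range ρ) = ⊤) :
    Simple (FDRep.of ρ) := by
  have : NeZero (Nat.card G : ℂ) := ⟨by exact_mod_cast Nat.card_pos.ne'⟩
  rw [FDRep.simple_iff_end_is_rank_one]
  have hid : (𝟙 (FDRep.of ρ)) ≠ 0 := by
    intro h0
    obtain ⟨v, hv⟩ := exists_ne (0 : W)
    have := congrArg (fun f : FDRep.of ρ ⟶ FDRep.of ρ => f.hom.hom.hom v) h0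
    exact hv this
  rw [finrank_eq_one_iff_of_nonzero' _ hid]
  intro f
  let F : End ℂ W := f.hom.hom.hom
  have hF : ∀ g, F * ρ g = ρ g * F := by
    intro g
    have := f.comm g
    have := congrArg (fun f  => f.hom.hom) this
    exact this
  have hF' : F ∈ Subalgebra.center ℂ (End ℂ W) := by
    rw [Subalgebra.mem_center_iff]
    intro T
    have hT : T ∈ Submodule.span ℂ (Set.range ρ) := h ▸ Submodule.mem_top
    induction hT using Submodule.span_induction with
    | mem x hx => obtain ⟨g, rfl⟩ := hx; exact (hF g).symm
    | zero => simp
    | add x y _ _ hx hy => rw [add_mul, mul_add, hx, hy]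
    | smul c x _ hx => rw [smul_mul_assoc, mul_smul_comm, hx]
  rw [Algebra.IsCentral.center_eq_bot, Algebra.mem_bot] at hF'
  obtain ⟨c, hc⟩ := hF'
  refine ⟨c, ?_⟩
  ext v
  exact LinearMap.congr_fun hc v

theorem FDRep.exists_simple_column_orthogonality (G : Type) [Group G] [Finite G] :
    ∃ (n : ℕ) (V : Fin n → FDRep ℂ G), (∀ i, Simple (V i)) ∧ ∀ a b : G,
      ∑ i, (V i).character a * (V i).character b = Nat.card {x : G // a * x * b = x} := by
  classical
  obtain ⟨n, d, hd, ⟨e⟩⟩ :=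
    IsSemisimpleRing.exists_algEquiv_pi_matrix_of_isAlgClosed ℂ (MonoidAlgebra ℂ G)
  let π : ∀ i, MonoidAlgebra ℂ G →ₐ[ℂ] End ℂ (Fin (d i) → ℂ) := fun i =>
    (Matrix.toLinAlgEquiv'.toAlgHom.comp (Pi.evalAlgHom ℂ _ i)).comp e.toAlgHom
  have hπ : ∀ i, Function.Surjective (π i) := fun i => by
    refine (Matrix.toLinAlgEquiv'.surjective.comp ?_).comp e.surjective
    exact Function.surjective_eval i
  let ρ : ∀ i, Representation ℂ G (Fin (d i) → ℂ) := fun i =>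
    (π i : MonoidAlgebra ℂ G →* End ℂ (Fin (d i) → ℂ)).comp (MonoidAlgebra.of ℂ G)
  have hρ : ∀ i g, (FDRep.of (ρ i)).character g = (e (MonoidAlgebra.of ℂ G g) i).trace := by
    intro i g
    exact Matrix.trace_toLin'_eq _
  refine ⟨n, fun i => FDRep.of (ρ i), fun i => ?_, fun a b => ?_⟩
  · have := hd i
    apply FDRep.simple_of_span_eq_top
    have h1 : Set.range (ρ i) = (π i).toLinearMap '' Set.range (MonoidAlgebra.of ℂ G) := by
      rw [← Set.range_comp]; rfl
    have h2 : Submodule.span ℂ (Set.range (MonoidAlgebra.of ℂ G)) = ⊤ := by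
      rw [eq_top_iff]
      intro x _
      exact Submodule.span_mono (Set.image_subset_range _ _) (MonoidAlgebra.mem_span_support_coeff x)
    rw [h1, ← Submodule.map_span, h2, Submodule.map_top, LinearMap.range_eq_top]
    exact hπ i
  · simp_rw [hρ]
    rw [← Matrix.trace_pi_mulLeftRight, ← MonoidAlgebra.trace_mulLeftRight_of,
      ← LinearMap.trace_conj' _ e.toLinearEquiv, AlgEquiv.linearEquivConj_mulLeftRight]
    rfl

/-- The values of characters of `G`, and the effect on them of power maps, descend to any
algebraically closed subfield of `ℂ`. -/
theorem FDRep.exists_character_pow_eq_sum {E : Type*} [Field E] (ι : E →+* ℂ) {G : Type}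
    [Group G] [Finite G] {ζ : E} (hζ : IsPrimitiveRoot ζ (Nat.card G)) (V : FDRep ℂ G) (h : G) :
    ∃ (t : Finset ℂ) (m r : ℂ → ℕ), ∀ k : ℕ,
      ι (∑ μ ∈ t, (m μ : E) * (ζ ^ r μ) ^ k) = V.character (h ^ k) := by
  have hN : Nat.card G ≠ 0 := Nat.card_pos.ne'
  have : NeZero (Nat.card G) := ⟨hN⟩
  obtain ⟨t, m, ht, hm⟩ := Module.End.exists_trace_pow_eq_sum (V.ρ h) hN
    (by rw [← map_pow, pow_card_eq_one', map_one])
  have hr : ∀ μ, ∃ r : ℕ, μ ∈ t → ι ζ ^ r = μ := fun μ => by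
    by_cases hμ : μ ∈ t
    · obtain ⟨r, _, hr⟩ := (hζ.map_of_injective ι.injective).eq_pow_of_pow_eq_one (ht μ hμ)
      exact ⟨r, fun _ => hr⟩
    · exact ⟨0, fun h => absurd h hμ⟩
  choose r hr using hr
  refine ⟨t, m, r, fun k => ?_⟩
  rw [FDRep.character, map_pow, hm, map_sum]
  refine Finset.sum_congr rfl fun μ hμ => ?_
  rw [map_mul, map_natCast, map_pow, map_pow, hr μ hμ]

theorem FDRep.exists_isIntegral_eq_character {E : Type*} [Field E] (ι : E →+* ℂ) {G : Type}
    [Group G] [Finite G] {ζ : E} (hζ : IsPrimitiveRoot ζ (Nat.card G)) (V : FDRep ℂ G) (h : G) :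
    ∃ x : E, IsIntegral ℤ x ∧ ι x = V.character h := by
  obtain ⟨t, m, r, H⟩ := FDRep.exists_character_pow_eq_sum ι hζ V h
  refine ⟨_, ?_, (H 1).trans (by rw [pow_one])⟩
  exact IsIntegral.sum _ fun μ _ =>
    (isIntegral_natCast (m μ)).mul (((hζ.isIntegral Nat.card_pos).pow (r μ)).pow 1)

/-- Field automorphisms act on character values through power maps. -/
theorem FDRep.exists_coprime_map_eq_character_pow {E : Type*} [Field E] [Algebra ℚ E]
    (ι : E →+* ℂ) {G : Type} [Group G] [Finite G] {ζ : E} (hζ : IsPrimitiveRoot ζ (Nat.card G))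
    (τ : E ≃ₐ[ℚ] E) :
    ∃ k : ℕ, k.Coprime (Nat.card G) ∧ ∀ (V : FDRep ℂ G) (h : G) (x : E),
      ι x = V.character h → ι (τ x) = V.character (h ^ k) := by
  have : NeZero (Nat.card G) := ⟨Nat.card_pos.ne'⟩
  obtain ⟨k, -, hk, hτ⟩ := hζ.isPrimitiveRoot_iff.1 (hζ.map_of_injective τ.injective)
  refine ⟨k, hk, fun V h x hx => ?_⟩
  obtain ⟨t, m, r, H⟩ := FDRep.exists_character_pow_eq_sum ι hζ V h
  obtain rfl : x = _ := ι.injective (hx.trans ((pow_one h ▸ H 1).symm))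
  rw [← H k, map_sum]
  congr 1
  refine Finset.sum_congr rfl fun μ _ => ?_
  rw [map_mul, map_natCast, map_pow, map_pow, ← hτ, pow_one, ← pow_mul, ← pow_mul, mul_comm k]

theorem FDRep.character_eq_of_isConj {G : Type} [Group G] (V : FDRep ℂ G) {a b : G}
    (h : IsConj a b) : V.character a = V.character b := by
  obtain ⟨c, rfl⟩ := isConj_iff.1 h
  exact (V.char_conj a c).symm

/-- A conjugacy class of the symmetric group meets the alternating group in at most two classes. -/
theorem alternatingGroup.isConj_or_isConj {α : Type*} [Fintype α] [DecidableEq α]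
    {a b c : alternatingGroup α} (hab : IsConj (a : Equiv.Perm α) b) (h : ¬ IsConj a b)
    (hac : IsConj (a : Equiv.Perm α) c) : IsConj a c ∨ IsConj b c := by
  obtain ⟨t, ht⟩ := isConj_iff.1 hab
  obtain ⟨u, hu⟩ := isConj_iff.1 hac
  have hodd : t.sign = -1 := (Int.units_eq_one_or t.sign).resolve_left fun h1 =>
    h (isConj_iff.2 ⟨⟨t, h1⟩, Subtype.ext ht⟩)
  rcases Int.units_eq_one_or u.sign with h1 | h1
  · exact Or.inl (isConj_iff.2 ⟨⟨u, h1⟩, Subtype.ext hu⟩)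
  · refine Or.inr (isConj_iff.2 ⟨⟨u * t⁻¹, ?_⟩, Subtype.ext ?_⟩)
    · rw [Equiv.Perm.mem_alternatingGroup, map_mul, Equiv.Perm.sign_inv, h1, hodd]; rfl
    · simp only [Subgroup.coe_mul, Subgroup.coe_inv, ← ht, ← hu]
      group

theorem card_mul_mul_inv_eq_self {G : Type*} [Group G] (a : G) :
    Nat.card {x : G // a * x * a⁻¹ = x} = Nat.card (Subgroup.centralizer {a}) :=
  Nat.card_congr (Equiv.subtypeEquivRight fun x => by
    rw [Subgroup.mem_centralizer_singleton_iff, mul_inv_eq_iff_eq_mul, eq_comm])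

theorem card_mul_mul_inv_eq_zero {G : Type*} [Group G] {a b : G} (h : ¬ IsConj a b) :
    Nat.card {x : G // a * x * b⁻¹ = x} = 0 := by
  have : IsEmpty {x : G // a * x * b⁻¹ = x} := ⟨fun ⟨x, hx⟩ =>
    h (isConj_comm.1 (isConj_iff.2 ⟨x, by rw [mul_inv_eq_iff_eq_mul] at hx ⊢; exact hx.symm⟩))⟩
  exact Nat.card_of_isEmpty

theorem centralizer_singleton_pow_of_coprime {G : Type*} [Group G] (a : G) {k : ℕ}
    (hk : k.Coprime (orderOf a)) :
    Subgroup.centralizer {a ^ k} = Subgroup.centralizer {a} := by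
  obtain ⟨m, hm⟩ := exists_pow_eq_self_of_coprime hk
  ext x
  rw [Subgroup.mem_centralizer_singleton_iff, Subgroup.mem_centralizer_singleton_iff]
  refine ⟨fun h => ?_, fun h => Commute.pow_right h k⟩
  have := Commute.pow_right (show Commute x (a ^ k) from h) m
  rwa [hm] at this

/-- For `G = Aₙ` and `g ∈ G` there is a positive integer `e` with
`e² ∣ n!` and `e · ℤ_{ℚ(g)} ⊆ ℤ[g]`. -/
theorem exists_sq_dvd_factorial_mul_mem_of_alternating (n : ℕ)
    (g : alternatingGroup (Fin n)) :
    ∃ e : ℕ, 0 < e ∧ e ^ 2 ∣ n.factorial ∧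
      ∀ x ∈ ringOfIntIn (charFieldAt g), (e : ℂ) * x ∈ charRingAt g := by
  let E := AlgebraicClosure ℚ
  let : Algebra ℚ E := AlgebraicClosure.instAlgebra ℚ
  have : IsGalois ℚ E := inferInstance
  let ι : E →+* ℂ := (IsAlgClosed.lift (R := ℚ) (S := E) (M := ℂ)).toRingHom
  have : NeZero (Nat.card (alternatingGroup (Fin n))) := ⟨Nat.card_pos.ne'⟩
  obtain ⟨ζ, hζ⟩ :=
    HasEnoughRootsOfUnity.exists_primitiveRoot E (Nat.card (alternatingGroup (Fin n)))
  let S : Set E := ι ⁻¹' charValuesAt g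
  have hSi : ∀ x ∈ S, IsIntegral ℤ x := by
    rintro x ⟨V, _, hV⟩
    obtain ⟨y, hy, hyV⟩ := FDRep.exists_isIntegral_eq_character ι hζ V g
    rwa [ι.injective (hV.symm.trans hyV.symm)]
  have himage : ι '' S = charValuesAt g := by
    refine Set.image_preimage_eq_of_subset ?_
    rintro _ ⟨V, _, rfl⟩
    obtain ⟨x, -, hx⟩ := FDRep.exists_isIntegral_eq_character ι hζ V g
    exact ⟨x, hx⟩
  have hfield : charFieldAt g = (Subfield.closure S).map ι := by
    rw [charFieldAt, RingHom.map_field_closure, himage]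
  have hring : charRingAt g = (Subring.closure S).map ι := by
    rw [charRingAt, RingHom.map_closure, himage]
  have descend : ∀ e : ℕ, (∀ x ∈ Subfield.closure S, IsIntegral ℤ x →
      (e : E) * x ∈ Subring.closure S) →
      ∀ x ∈ ringOfIntIn (charFieldAt g), (e : ℂ) * x ∈ charRingAt g := by
    rintro e he x ⟨hxi, hx⟩
    rw [hfield] at hx
    obtain ⟨y, hy, rfl⟩ := hx
    rw [hring]
    have hyi : IsIntegral ℤ y :=
      (isIntegral_algHom_iff (ι.toIntAlgHom) ι.injective).1 hxi
    exact ⟨e * y, he y hy hyi, by rw [map_mul, map_natCast]⟩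
  by_cases hfix : ∀ (τ : E ≃ₐ[ℚ] E), ∀ s ∈ S, τ s = s
  · refine ⟨1, one_pos, one_dvd _, descend 1 fun x hx hxi => ?_⟩
    obtain ⟨m, rfl⟩ := exists_intCast_eq_of_forall_fixed hxi fun τ =>
      RingHom.eqOn_field_closure (f := (τ : E →+* E)) (g := RingHom.id E)
        (fun s hs => hfix τ s hs) hx
    rw [Nat.cast_one, one_mul]
    exact intCast_mem _ m
  push Not at hfix
  obtain ⟨σ, s₀, hs₀, hne⟩ := hfix
  obtain ⟨k, hk, hσ⟩ := FDRep.exists_coprime_map_eq_character_pow ι hζ σ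
  have hperm : ∀ j : ℕ, j.Coprime (Nat.card (alternatingGroup (Fin n))) →
      IsConj (g : Equiv.Perm (Fin n)) ((g ^ j : alternatingGroup (Fin n)) : Equiv.Perm (Fin n)) := by
    intro j hj
    rw [Equiv.Perm.isConj_iff_cycleType_eq, Subgroup.coe_pow,
      Equiv.Perm.cycleType_pow_of_coprime]
    rw [Subgroup.orderOf_coe]
    exact hj.coprime_dvd_right (orderOf_dvd_natCard g)
  have hnc : ¬ IsConj g (g ^ k) := by
    obtain ⟨V, _, hV⟩ := id hs₀
    exact fun h => hne (ι.injective
      ((hσ V g s₀ hV.symm).trans ((V.character_eq_of_isConj h).symm.trans hV)))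
  have hpow : ∀ j : ℕ, j.Coprime (Nat.card (alternatingGroup (Fin n))) →
      IsConj g (g ^ j) ∨ IsConj (g ^ k) (g ^ j) :=
    fun j hj => alternatingGroup.isConj_or_isConj (hperm k hk) hnc (hperm j hj)
  have hall : ∀ τ : E ≃ₐ[ℚ] E, (∀ s ∈ S, τ s = s) ∨ (∀ s ∈ S, τ s = σ s) := fun τ => by
    obtain ⟨j, hj, hτ⟩ := FDRep.exists_coprime_map_eq_character_pow ι hζ τ
    refine (hpow j hj).imp ?_ ?_
    · rintro h s ⟨V, _, hV⟩
      exact ι.injective ((hτ V g s hV.symm).trans ((V.character_eq_of_isConj h).symm.trans hV))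
    · rintro h s ⟨V, _, hV⟩
      exact ι.injective ((hτ V g s hV.symm).trans
        ((V.character_eq_of_isConj h).symm.trans (hσ V g s hV.symm).symm))
  have hσσ : ∀ s ∈ S, σ (σ s) = s := by
    rcases hall (σ * σ) with h | h
    · exact h
    · exact absurd (σ.injective (h s₀ hs₀)) hne
  obtain ⟨f, hf, hfO, hfS⟩ := exists_conductor hSi σ ⟨s₀, hs₀, hne⟩ hall
  refine ⟨f, hf, ?_, descend f hfO⟩
  obtain ⟨r, V, hV, horth⟩ := FDRep.exists_simple_column_orthogonality (alternatingGroup (Fin n))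
  have hx : ∀ i, ∃ x : E, ι x = (V i).character g := fun i =>
    (FDRep.exists_isIntegral_eq_character ι hζ (V i) g).imp fun _ h => h.2
  choose x hx using hx
  have hxS : ∀ i, x i ∈ S := fun i => ⟨V i, hV i, (hx i).symm⟩
  choose c hc using fun i => hfS (x i) (hxS i)
  have hinv : ∃ ε : ℤ, ∀ i, (V i).character g⁻¹ - (V i).character (g ^ k)⁻¹ =
      ε * ι (x i - σ (x i)) := by
    have hginv : g ^ (Nat.card (alternatingGroup (Fin n)) - 1) = g⁻¹ := by
      rw [eq_inv_iff_mul_eq_one, ← pow_succ, Nat.sub_add_cancel Nat.card_pos, pow_card_eq_one']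
    have hcop : (Nat.card (alternatingGroup (Fin n)) - 1).Coprime
        (Nat.card (alternatingGroup (Fin n))) := by
      have h := Nat.coprime_self_add_right (m := Nat.card (alternatingGroup (Fin n)) - 1) (n := 1)
      rw [Nat.sub_add_cancel Nat.card_pos] at h
      exact h.2 (Nat.coprime_one_right _)
    rcases hpow _ hcop with h | h <;> rw [hginv] at h
    · refine ⟨1, fun i => ?_⟩
      have h1 : ι (x i) = (V i).character g⁻¹ := (hx i).trans ((V i).character_eq_of_isConj h)
      rw [← inv_pow, ← hσ (V i) _ _ h1, ← h1, map_sub, Int.cast_one, one_mul]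
    · refine ⟨-1, fun i => ?_⟩
      have h1 : ι (σ (x i)) = (V i).character g⁻¹ :=
        (hσ (V i) g _ (hx i)).trans ((V i).character_eq_of_isConj h)
      rw [← inv_pow, ← hσ (V i) _ _ h1, ← h1, hσσ _ (hxS i), map_sub]
      push_cast
      ring
  obtain ⟨ε, hε⟩ := hinv
  have hcard : ((2 * Nat.card (Subgroup.centralizer {g}) : ℕ) : ℂ) =
      ∑ i, ((V i).character g - (V i).character (g ^ k)) *
        ((V i).character g⁻¹ - (V i).character (g ^ k)⁻¹) := by
    simp only [sub_mul, mul_sub, Finset.sum_sub_distrib, horth]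
    rw [card_mul_mul_inv_eq_self, card_mul_mul_inv_eq_self, card_mul_mul_inv_eq_zero hnc,
      card_mul_mul_inv_eq_zero (fun h => hnc h.symm), centralizer_singleton_pow_of_coprime g
        (hk.coprime_dvd_right (orderOf_dvd_natCard g))]
    push_cast
    ring
  have hsum : ((2 * Nat.card (Subgroup.centralizer {g}) : ℕ) : ℤ) =
      (f ^ 2 : ℕ) * (ε * ∑ i, c i) := by
    apply Int.cast_injective (α := ℂ)
    rw [Int.cast_natCast, hcard, ← mul_assoc, Finset.mul_sum, Int.cast_sum]
    refine Finset.sum_congr rfl fun i _ => ?_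
    rw [hε, ← hσ (V i) g _ (hx i), ← hx i, ← map_sub, mul_left_comm, ← sq, ← map_pow, hc,
      map_intCast]
    push_cast
    ring
  have hnt : Nontrivial (Fin n) := by
    by_contra hcon
    rw [not_nontrivial_iff_subsingleton] at hcon
    exact hnc (Subsingleton.elim g (g ^ k) ▸ IsConj.refl g)
  have hfact : 2 * Nat.card (alternatingGroup (Fin n)) = n.factorial := by
    rw [two_mul_nat_card_alternatingGroup, Nat.card_perm, Nat.card_fin]
  rw [← hfact]
  exact (Int.natCast_dvd_natCast.1 (Dvd.intro _ hsum.symm)).trans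
    (Nat.mul_dvd_mul_left 2 (Subgroup.card_subgroup_dvd_card _))
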